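/- arXiv:2510.16817 — 5 statements merged into one kernel-verified Lean document; each statement's English description precedes it below -/
import Mathlib

section
/- The double Lebesgue integral ∫_{−π}^{π} ∫_{−π}^{π} (√|s| − √|t|)² / (s − t)² ds dt equals 12π·log 2 − 2π². In particular, the H^{1/2}-type Gagliardo seminorm of the function g₀(t) = |t|^{1/2} on [−π, π] is finite. -/
open MeasureTheory Real

/-- The even part in `s` of the Gagliardo kernel of `√|·|` has an explicit integral on `(0, r)`,
independent of `r` by homogeneity. -/
lemma lintegral_folded_kernel {r : ℝ} (hr : 0 < r) :
    ∫⁻ s in Set.Ioo 0 r,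
        ENNReal.ofReal (1 / (√s + √r) ^ 2 + (√s - √r) ^ 2 / (s + r) ^ 2)
      = ENNReal.ofReal (3 * Real.log 2 - π / 2) := by
  set f : ℝ → ℝ := fun s => 1 / (√s + √r) ^ 2 + (√s - √r) ^ 2 / (s + r) ^ 2 with hf
  set G : ℝ → ℝ := fun s => 2 * Real.log (√s + √r) + 2 * √r / (√s + √r) + Real.log (s + r)
    + 2 * √r * √s / (s + r) - 2 * Real.arctan (√s / √r) with hG
  have ha : 0 < √r := Real.sqrt_pos.2 hr
  have hcont : ContinuousOn G (Set.Icc 0 r) := by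
    intro s hs
    have h0 : 0 ≤ √s := Real.sqrt_nonneg s
    have h1 : √s + √r ≠ 0 := by positivity
    have h2 : s + r ≠ 0 := by have := hs.1; positivity
    apply ContinuousAt.continuousWithinAt
    fun_prop (disch := first | assumption | exact ha.ne')
  have hderiv : ∀ s ∈ Set.Ioo 0 r, HasDerivAt G (f s) s := by
    intro s hs
    have hx : 0 < √s := Real.sqrt_pos.2 hs.1
    have hsq := Real.hasDerivAt_sqrt hs.1.ne'
    have h1 : √s + √r ≠ 0 := by positivity
    have h2 : s + r ≠ 0 := by have := hs.1; positivity
    have d1 := hsq.add_const (√r)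
    have d2 := (hasDerivAt_id s).add_const r
    have D := ((((d1.log h1).const_mul 2).add ((hasDerivAt_const s (2 * √r)).div d1 h1)).add
      (d2.log h2)).add ((hsq.const_mul (2 * √r)).div d2 h2) |>.sub
      ((hsq.div_const (√r)).arctan.const_mul 2)
    refine D.congr_deriv ?_
    have es : s = √s ^ 2 := (Real.sq_sqrt hs.1.le).symm
    have er : r = √r ^ 2 := (Real.sq_sqrt hr.le).symm
    simp only [hf, id]
    generalize √s = x at *
    generalize √r = a at *
    subst es er
    field_simp
    ring
  have hnonneg : ∀ s, 0 ≤ f s := fun s => by positivity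
  have hint : IntegrableOn f (Set.Ioc 0 r) :=
    intervalIntegral.integrableOn_deriv_of_nonneg hcont hderiv fun s _ => hnonneg s
  have hval : ∫ s in (0 : ℝ)..r, f s = G r - G 0 :=
    intervalIntegral.integral_eq_sub_of_hasDerivAt_of_le hr.le hcont hderiv
      ((intervalIntegrable_iff_integrableOn_Ioc_of_le hr.le).2 hint)
  rw [setLIntegral_congr Ioo_ae_eq_Ioc,
    ← ofReal_integral_eq_lintegral_ofReal hint (ae_of_all _ hnonneg),
    ← intervalIntegral.integral_of_le hr.le, hval]
  congr 1
  have l1 : Real.log (√r + √r) = Real.log 2 + Real.log (√r) := by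
    rw [← two_mul, Real.log_mul two_ne_zero ha.ne']
  have l2 : Real.log (r + r) = Real.log 2 + Real.log r := by
    rw [← two_mul, Real.log_mul two_ne_zero hr.ne']
  have e1 : 2 * √r / (√r + √r) = 1 := by field_simp; norm_num
  have e2 : 2 * √r * √r / (r + r) = 1 := by
    rw [mul_assoc, Real.mul_self_sqrt hr.le]; field_simp; norm_num
  have e3 : 2 * √r / √r = 2 := by field_simp
  simp only [hG, l1, l2, e1, e2, e3, Real.sqrt_zero, zero_add, div_self ha.ne', Real.arctan_one,
    zero_div, Real.arctan_zero, mul_zero]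
  ring

lemma setLIntegral_Ioo_neg_self (r : ℝ) {g : ℝ → ENNReal} (hg : Measurable g) :
    ∫⁻ s in Set.Ioo (-r) r, g s = ∫⁻ s in Set.Ioo 0 r, (g s + g (-s)) := by
  have hneg : ∫⁻ s in Set.Ioo 0 r, g (-s) = ∫⁻ s in Set.Ioo (-r) 0, g s := by
    have := (Measure.measurePreserving_neg (volume : Measure ℝ)).setLIntegral_comp_preimage
      (measurableSet_Ioo (a := -r) (b := 0)) hg
    simpa using this
  rcases le_or_gt r 0 with hr | hr
  · simp [hr]
  · rw [lintegral_add_left hg, hneg, add_comm,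
      setLIntegral_congr (Ioo_ae_eq_Ico (a := (0 : ℝ)) (b := r)),
      ← lintegral_union measurableSet_Ico, Set.Ioo_union_Ico_eq_Ioo (by linarith) hr.le]
    exact Set.disjoint_left.2 fun x hx hy => absurd hx.2 (not_lt.2 hy.1)

/-- The Gagliardo kernel of `√|·|`. -/
noncomputable def sqrtAbsKernel (s t : ℝ) : ℝ := (√|s| - √|t|) ^ 2 / (s - t) ^ 2

lemma measurable_sqrtAbsKernel :
    Measurable fun p : ℝ × ℝ => sqrtAbsKernel p.1 p.2 := by
  unfold sqrtAbsKernel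
  fun_prop

lemma sqrtAbsKernel_nonneg (s t : ℝ) : 0 ≤ sqrtAbsKernel s t := by
  unfold sqrtAbsKernel
  positivity

lemma sqrtAbsKernel_comm (s t : ℝ) : sqrtAbsKernel s t = sqrtAbsKernel t s := by
  unfold sqrtAbsKernel
  rw [← neg_sub s t, neg_sq, ← neg_sub (√|s|), neg_sq]

lemma sqrtAbsKernel_neg_neg (s t : ℝ) : sqrtAbsKernel (-s) (-t) = sqrtAbsKernel s t := by
  unfold sqrtAbsKernel
  rw [abs_neg, abs_neg, neg_sub_neg, ← neg_sub s t, neg_sq]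

lemma sqrtAbsKernel_add_neg {s t : ℝ} (hs : 0 < s) (hst : s < |t|) :
    sqrtAbsKernel s t + sqrtAbsKernel (-s) t
      = 1 / (√s + √|t|) ^ 2 + (√s - √|t|) ^ 2 / (s + |t|) ^ 2 := by
  have key : ∀ u : ℝ, s < u → sqrtAbsKernel s u + sqrtAbsKernel (-s) u
      = 1 / (√s + √u) ^ 2 + (√s - √u) ^ 2 / (s + u) ^ 2 := by
    intro u hu
    have hu0 : 0 < u := hs.trans hu
    unfold sqrtAbsKernel
    rw [abs_neg, abs_of_pos hs, abs_of_pos hu0, ← neg_add', neg_sq]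
    congr 1
    have h : s - u = (√s - √u) * (√s + √u) := by
      linear_combination -Real.sq_sqrt hs.le + Real.sq_sqrt hu0.le
    have h1 : √s - √u ≠ 0 := (sub_neg.2 (Real.sqrt_lt_sqrt hs.le hu)).ne
    have h2 : √s + √u ≠ 0 := by have := Real.sqrt_pos.2 hs; positivity
    rw [h]
    field_simp
  rcases abs_cases t with ⟨ht, -⟩ | ⟨ht, -⟩
  · rw [ht] at hst ⊢
    exact key t hst
  · rw [ht] at hst ⊢
    have h := sqrtAbsKernel_neg_neg s (-t)
    rw [neg_neg] at h
    rw [← key (-t) hst, sqrtAbsKernel_neg_neg, h, add_comm]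

lemma lintegral_sqrtAbsKernel {t : ℝ} (ht : t ≠ 0) :
    ∫⁻ s in Set.Ioo (-|t|) |t|, ENNReal.ofReal (sqrtAbsKernel s t)
      = ENNReal.ofReal (3 * Real.log 2 - π / 2) := by
  have hm : Measurable fun s => ENNReal.ofReal (sqrtAbsKernel s t) := by
    unfold sqrtAbsKernel
    fun_prop
  rw [setLIntegral_Ioo_neg_self _ hm,
    ← lintegral_folded_kernel (abs_pos.2 ht)]
  refine setLIntegral_congr_fun measurableSet_Ioo fun s hs => ?_
  rw [← ENNReal.ofReal_add (sqrtAbsKernel_nonneg _ _) (sqrtAbsKernel_nonneg _ _),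
    sqrtAbsKernel_add_neg hs.1 hs.2]

lemma setLIntegral_const_of_forall_ne_zero {R : ℝ} {c : ENNReal} {F : ℝ → ENNReal}
    (hF : ∀ t ∈ Set.Icc (-R) R, t ≠ 0 → F t = c) :
    ∫⁻ t in Set.Icc (-R) R, F t = ENNReal.ofReal (2 * R) * c := by
  have : ∫⁻ t in Set.Icc (-R) R, F t = ∫⁻ _ in Set.Icc (-R) R, c := by
    refine setLIntegral_congr_fun_ae measurableSet_Icc ?_
    filter_upwards [Measure.ae_ne volume (0 : ℝ)] with t ht hmem using hF t hmem ht
  rw [this, setLIntegral_const, Real.volume_Icc, mul_comm]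
  congr 2
  ring

lemma lintegral_sqrtAbsKernel_square (R : ℝ) :
    ∫⁻ p : ℝ × ℝ in Set.Icc (-R) R ×ˢ Set.Icc (-R) R,
        ENNReal.ofReal (sqrtAbsKernel p.1 p.2)
      = 2 * (ENNReal.ofReal (2 * R) * ENNReal.ofReal (3 * Real.log 2 - π / 2)) := by
  set k : ℝ × ℝ → ENNReal := fun p => ENNReal.ofReal (sqrtAbsKernel p.1 p.2) with hk
  have hkm : Measurable k := measurable_sqrtAbsKernel.ennreal_ofReal
  set A : Set (ℝ × ℝ) := {p | |p.1| < |p.2|} with hA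
  have hAm : MeasurableSet A := measurableSet_lt (by fun_prop) (by fun_prop)
  have hlt : ∀ t ∈ Set.Icc (-R) R, t ≠ 0 →
      ∫⁻ s in Set.Icc (-R) R, A.indicator k (s, t) = ENNReal.ofReal (3 * Real.log 2 - π / 2) := by
    intro t ht ht0
    have hsub : Set.Ioo (-|t|) |t| ⊆ Set.Icc (-R) R := by
      have := abs_le.2 ht
      exact fun s hs => ⟨by linarith [hs.1], by linarith [hs.2]⟩
    have : (fun s => A.indicator k (s, t)) = (Set.Ioo (-|t|) |t|).indicator fun s => k (s, t) := by
      ext s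
      simp only [Set.indicator, hA, Set.mem_ofPred_eq, Set.mem_Ioo, abs_lt]
    rw [this, setLIntegral_indicator measurableSet_Ioo, Set.inter_eq_left.2 hsub]
    exact lintegral_sqrtAbsKernel ht0
  have hge : ∀ s ∈ Set.Icc (-R) R, s ≠ 0 →
      ∫⁻ t in Set.Icc (-R) R, Aᶜ.indicator k (s, t) = ENNReal.ofReal (3 * Real.log 2 - π / 2) := by
    intro s hs hs0
    have hsub : Set.Icc (-|s|) |s| ⊆ Set.Icc (-R) R := by
      have := abs_le.2 hs
      exact fun t ht => ⟨by linarith [ht.1], by linarith [ht.2]⟩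
    have : (fun t => Aᶜ.indicator k (s, t)) = (Set.Icc (-|s|) |s|).indicator fun t => k (t, s) := by
      ext t
      simp only [Set.indicator, hA, Set.mem_compl_iff, Set.mem_ofPred_eq, Set.mem_Icc, not_lt,
        ← abs_le, hk, sqrtAbsKernel_comm s t]
    rw [this, setLIntegral_indicator measurableSet_Icc, Set.inter_eq_left.2 hsub,
      ← setLIntegral_congr Ioo_ae_eq_Icc]
    exact lintegral_sqrtAbsKernel hs0
  have hsplit : k = fun p => A.indicator k p + Aᶜ.indicator k p :=
    (Set.indicator_self_add_compl A k).symm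
  rw [hsplit, lintegral_add_left (hkm.indicator hAm), Measure.volume_eq_prod,
    ← Measure.prod_restrict, lintegral_prod_symm _ (hkm.indicator hAm).aemeasurable,
    lintegral_prod _ (hkm.indicator hAm.compl).aemeasurable,
    setLIntegral_const_of_forall_ne_zero hlt, setLIntegral_const_of_forall_ne_zero hge,
    ← two_mul]

/-- The Gagliardo `H^{1/2}` seminorm squared of `g₀(t) = √|t|` on `[−π, π]`, i.e. the double
Lebesgue integral of `(√|s| − √|t|)²/(s − t)²` over `[−π,π]²`, equals `12π log 2 − 2π²`;
in particular it is finite. -/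
theorem stmt_4 :
    (∫ p : ℝ × ℝ in Set.Icc (-π) π ×ˢ Set.Icc (-π) π,
        (Real.sqrt |p.1| - Real.sqrt |p.2|) ^ 2 / (p.1 - p.2) ^ 2)
      = 12 * π * Real.log 2 - 2 * π ^ 2 ∧
    (∫⁻ p : ℝ × ℝ in Set.Icc (-π) π ×ˢ Set.Icc (-π) π,
        ENNReal.ofReal ((Real.sqrt |p.1| - Real.sqrt |p.2|) ^ 2 / (p.1 - p.2) ^ 2)) < ⊤ := by
  have h := lintegral_sqrtAbsKernel_square π
  have hc : 0 ≤ 3 * Real.log 2 - π / 2 := by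
    linarith [Real.log_two_gt_d9, Real.pi_lt_d2]
  change (∫ p : ℝ × ℝ in _, sqrtAbsKernel p.1 p.2) = _ ∧
    (∫⁻ p : ℝ × ℝ in _, ENNReal.ofReal (sqrtAbsKernel p.1 p.2)) < ⊤
  constructor
  · rw [integral_eq_lintegral_of_nonneg_ae (ae_of_all _ fun p => sqrtAbsKernel_nonneg _ _)
      measurable_sqrtAbsKernel.aestronglyMeasurable, h, ENNReal.toReal_mul, ENNReal.toReal_mul,
      ENNReal.toReal_ofReal (by positivity), ENNReal.toReal_ofReal hc, ENNReal.toReal_ofNat]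
    ring
  · rw [h]
    exact ENNReal.mul_lt_top ENNReal.ofNat_lt_top
      (ENNReal.mul_lt_top ENNReal.ofReal_lt_top ENNReal.ofReal_lt_top)
end

section
/- Define g₁ : [0, 2π] → ℝ by g₁(t) = 1/2 − √(|t − π/2|/(2π)) for 0 ≤ t < π and g₁(t) = √(|t − 3π/2|/(2π)) − 1/2 for π ≤ t ≤ 2π. Then the Gagliardo double integral ∫_0^{2π} ∫_0^{2π} |g₁(s) − g₁(t)|² / (s − t)² ds dt is finite. -/
open MeasureTheory Real

lemma sq_sqrt_sub_sqrt_le {a b d : ℝ} (ha : 0 < a) (hb : 0 < b) (h : |a - b| ≤ |d|) :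
    (√a - √b) ^ 2 ≤ (1 / √a) * (1 / √b) * d ^ 2 := by
  have hx := Real.sqrt_pos.2 ha
  have hy := Real.sqrt_pos.2 hb
  have h2 : (a - b) ^ 2 ≤ d ^ 2 := sq_le_sq.2 h
  have hab : a - b = (√a - √b) * (√a + √b) := by
    linear_combination -(Real.sq_sqrt ha.le) + Real.sq_sqrt hb.le
  rw [one_div_mul_one_div, one_div_mul_eq_div, le_div_iff₀ (by positivity)]
  refine le_trans ?_ h2
  rw [hab, mul_pow]
  gcongr
  nlinarith [mul_pos hx hy]

lemma integrableOn_one_div_sqrt_abs_sub {a b : ℝ} (hab : a ≤ b) (c : ℝ) :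
    IntegrableOn (fun t : ℝ => 1 / √|t - c|) (Set.Icc a b) := by
  have hloc : LocallyIntegrable (fun t : ℝ => 1 / √|t|) volume := by
    refine locallyIntegrable_of_norm_le_rpow (C := 1) (α := 1 / 2) (by simp) (by norm_num)
      (Filter.Eventually.of_forall fun x => ?_)
      (by fun_prop : Measurable fun t : ℝ => 1 / √|t|).aestronglyMeasurable
    rw [Real.norm_of_nonneg (by positivity), one_mul, Real.rpow_neg (norm_nonneg _),
      ← Real.sqrt_eq_rpow, Real.norm_eq_abs, one_div]
  have hint : IntervalIntegrable (fun t : ℝ => 1 / √|t|) volume (a - c) (b - c) :=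
    (hloc.integrableOn_isCompact isCompact_uIcc).intervalIntegrable
  have := hint.comp_sub_right c
  simp only [sub_add_cancel] at this
  exact (intervalIntegrable_iff_integrableOn_Icc_of_le hab).1 this

lemma lintegral_prod_lt_top_of_le_mul {S : Set ℝ} {F : ℝ × ℝ → ℝ} {w : ℝ → ℝ}
    (hw : IntegrableOn w S) {N : Set ℝ} (hN : volume N = 0)
    (hF : ∀ s ∉ N, ∀ t ∉ N, F (s, t) ≤ w s * w t) :
    (∫⁻ p in S ×ˢ S, ENNReal.ofReal (F p)) < ⊤ := by
  rw [Measure.volume_eq_prod, ← Measure.prod_restrict]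
  have hNae : ∀ᵐ s ∂(volume.restrict S), s ∉ N :=
    ae_restrict_of_ae (measure_eq_zero_iff_ae_notMem.1 hN)
  refine lt_of_le_of_lt (lintegral_mono_ae
    (g := fun p => ENNReal.ofReal (w p.1 * w p.2)) ?_) (hw.mul_prod hw).lintegral_lt_top
  filter_upwards [Measure.quasiMeasurePreserving_fst.ae hNae,
    Measure.quasiMeasurePreserving_snd.ae hNae] with p h₁ h₂
  exact ENNReal.ofReal_le_ofReal (hF p.1 h₁ p.2 h₂)

/-- For the sharp-peaked boundary datum `g₁` on `[0, 2π]`, given by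
`g₁(t) = 1/2 − √(|t − π/2|/(2π))` for `t < π` and `g₁(t) = √(|t − 3π/2|/(2π)) − 1/2` for
`t ≥ π`, the Gagliardo `H^{1/2}` double integral over `[0,2π]²` is finite. -/
theorem stmt_6 (g₁ : ℝ → ℝ)
    (hg₁ : ∀ t, g₁ t =
      if t < π then 1 / 2 - Real.sqrt (|t - π / 2| / (2 * π))
      else Real.sqrt (|t - 3 * π / 2| / (2 * π)) - 1 / 2) :
    (∫⁻ p : ℝ × ℝ in Set.Icc 0 (2 * π) ×ˢ Set.Icc 0 (2 * π),
        ENNReal.ofReal ((g₁ p.1 - g₁ p.2) ^ 2 / (p.1 - p.2) ^ 2)) < ⊤ := by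
  have hπ := Real.pi_gt_three
  have hw : IntegrableOn (fun t : ℝ => 1 / √|t - π / 2| + 1 / √|t - 3 * π / 2| + 1)
      (Set.Icc 0 (2 * π)) :=
    ((integrableOn_one_div_sqrt_abs_sub Real.two_pi_pos.le _).add
      (integrableOn_one_div_sqrt_abs_sub Real.two_pi_pos.le _)).add (integrableOn_const measure_Icc_lt_top.ne)
  refine lintegral_prod_lt_top_of_le_mul
    (F := fun p => (g₁ p.1 - g₁ p.2) ^ 2 / (p.1 - p.2) ^ 2) hw (N := {π / 2, 3 * π / 2})
    ((Set.toFinite _).measure_zero _) ?_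
  have hquarter : √(π / 2) / √(2 * π) = 1 / 2 := by
    rw [← Real.sqrt_div (by positivity), show π / 2 / (2 * π) = (1 / 2) ^ 2 by field_simp,
      Real.sqrt_sq (by norm_num)]
  have hg : ∀ t, g₁ t = (√|max t π - 3 * π / 2| - √|min t π - π / 2|) / √(2 * π) := by
    intro t
    rw [hg₁, sub_div]
    split_ifs with h
    · rw [max_eq_right h.le, min_eq_left h.le, Real.sqrt_div (abs_nonneg _),
        show π - 3 * π / 2 = -(π / 2) by ring, abs_neg, abs_of_pos (by positivity : 0 < π / 2),
        hquarter]
    · rw [max_eq_left (not_lt.1 h), min_eq_right (not_lt.1 h), Real.sqrt_div (abs_nonneg _),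
        show π - π / 2 = π / 2 by ring, abs_of_pos (by positivity : 0 < π / 2), hquarter]
  have hle : ∀ u : ℝ, 0 < |u| → ∀ v, (v = u ∨ 1 ≤ |v|) →
      0 < |v| ∧ 1 / √|v| ≤ 1 / √|u| + 1 := by
    rintro u hu v (rfl | hv)
    · exact ⟨hu, by linarith⟩
    · have : 1 / √|v| ≤ 1 := by
        rw [div_le_one (by positivity)]
        exact Real.one_le_sqrt.2 hv
      exact ⟨by linarith, by linarith [show 0 ≤ 1 / √|u| by positivity]⟩
  have hmin : ∀ t ∉ ({π / 2, 3 * π / 2} : Set ℝ), 0 < |min t π - π / 2| ∧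
      1 / √|min t π - π / 2| ≤ 1 / √|t - π / 2| + 1 := by
    intro t ht
    simp only [Set.mem_insert_iff, Set.mem_singleton_iff, not_or] at ht
    refine hle _ (abs_pos.2 (sub_ne_zero.2 ht.1)) _ ?_
    rcases le_total t π with h | h
    · simp [h]
    · right
      rw [min_eq_right h]
      exact le_trans (by linarith) (le_abs_self _)
  have hmax : ∀ t ∉ ({π / 2, 3 * π / 2} : Set ℝ), 0 < |max t π - 3 * π / 2| ∧
      1 / √|max t π - 3 * π / 2| ≤ 1 / √|t - 3 * π / 2| + 1 := by
    intro t ht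
    simp only [Set.mem_insert_iff, Set.mem_singleton_iff, not_or] at ht
    refine hle _ (abs_pos.2 (sub_ne_zero.2 ht.2)) _ ?_
    rcases le_total t π with h | h
    · right
      rw [max_eq_right h]
      exact le_trans (by linarith) (neg_le_abs _)
    · simp [h]
  intro s hs t ht
  obtain ⟨as, bs⟩ := hmin s hs
  obtain ⟨at₀, bt⟩ := hmin t ht
  obtain ⟨cs, ds⟩ := hmax s hs
  obtain ⟨ct, dt⟩ := hmax t ht
  have h₁ := sq_sqrt_sub_sqrt_le (d := s - t) as at₀ <| (abs_abs_sub_abs_le _ _).trans <| by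
    rw [sub_sub_sub_cancel_right]
    simpa using abs_min_sub_min_le_max s π t π
  have h₂ := sq_sqrt_sub_sqrt_le (d := s - t) cs ct <| (abs_abs_sub_abs_le _ _).trans <| by
    rw [sub_sub_sub_cancel_right]
    exact abs_max_sub_max_le_abs _ _ _
  set W : ℝ → ℝ := fun t => 1 / √|t - π / 2| + 1 / √|t - 3 * π / 2| + 1 with hW
  have hW0 : ∀ t, 0 ≤ W t := fun t => by positivity
  have e₁ : (1 / √|min s π - π / 2|) * (1 / √|min t π - π / 2|) ≤ W s * W t :=
    mul_le_mul (bs.trans (by simp only [hW]; linarith [show 0 ≤ 1 / √|s - 3 * π / 2| by positivity]))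
      (bt.trans (by simp only [hW]; linarith [show 0 ≤ 1 / √|t - 3 * π / 2| by positivity]))
      (by positivity) (hW0 s)
  have e₂ : (1 / √|max s π - 3 * π / 2|) * (1 / √|max t π - 3 * π / 2|) ≤ W s * W t :=
    mul_le_mul (ds.trans (by simp only [hW]; linarith [show 0 ≤ 1 / √|s - π / 2| by positivity]))
      (dt.trans (by simp only [hW]; linarith [show 0 ≤ 1 / √|t - π / 2| by positivity]))
      (by positivity) (hW0 s)
  have f₁ := h₁.trans (mul_le_mul_of_nonneg_right e₁ (sq_nonneg _))
  have f₂ := h₂.trans (mul_le_mul_of_nonneg_right e₂ (sq_nonneg _))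
  have hWW := mul_nonneg (mul_nonneg (hW0 s) (hW0 t)) (sq_nonneg (s - t))
  refine div_le_of_le_mul₀ (sq_nonneg _) (mul_nonneg (hW0 s) (hW0 t)) ?_
  simp only
  rw [hg, hg, ← sub_div, div_pow, Real.sq_sqrt (by positivity), div_le_iff₀ (by positivity)]
  generalize W s * W t * (s - t) ^ 2 = Q at *
  generalize √|min s π - π / 2| = x at *
  generalize √|min t π - π / 2| = y at *
  generalize √|max s π - 3 * π / 2| = z at *
  generalize √|max t π - 3 * π / 2| = u at *
  nlinarith [sq_nonneg ((x - y) + (z - u)), mul_nonneg hWW (by linarith : 0 ≤ 2 * π - 4)]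
end

section
/- Define g₁ : [0, 2π] → ℝ by g₁(t) = 1/2 − √(|t − π/2|/(2π)) for 0 ≤ t < π and g₁(t) = √(|t − 3π/2|/(2π)) − 1/2 for π ≤ t ≤ 2π. Then g₁ is differentiable at every point of (0, 2π) except t ∈ {π/2, π, 3π/2}, and its derivative is not square-integrable on (0, 2π): in particular ∫_0^{π} 1/(8π·|t − π/2|) dt = ∞, where 1/(8π|t − π/2|) = |g₁′(t)|² for t ∈ (0, π) \ {π/2}. Consequently g₁ does not belong to H¹((0, 2π)). -/
open MeasureTheory Real

/-- The square-root cusp `t ↦ √(|t - a| / c)` is differentiable away from its tip `a`. -/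
theorem hasDerivAt_sqrt_abs_sub_div {a c t : ℝ} (hc : 0 < c) (ht : t ≠ a) :
    HasDerivAt (fun s => √(|s - a| / c))
      ((SignType.sign (t - a) : ℝ) / c / (2 * √(|t - a| / c))) t := by
  have h0 : t - a ≠ 0 := sub_ne_zero.mpr ht
  have h1 : HasDerivAt (fun s : ℝ => |s - a|) (SignType.sign (t - a) : ℝ) t := by
    simpa [Function.comp_def] using (hasDerivAt_abs h0).comp t ((hasDerivAt_id t).sub_const a)
  exact (h1.div_const c).sqrt (div_pos (abs_pos.mpr h0) hc).ne'

theorem sq_deriv_sqrt_abs_sub_div {a c t : ℝ} (hc : 0 < c) (ht : t ≠ a) :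
    ((SignType.sign (t - a) : ℝ) / c / (2 * √(|t - a| / c))) ^ 2 = 1 / (4 * c * |t - a|) := by
  have h0 : t - a ≠ 0 := sub_ne_zero.mpr ht
  have hpos : 0 < |t - a| := abs_pos.mpr h0
  have hs : (SignType.sign (t - a) : ℝ) ^ 2 = 1 := by
    rcases lt_or_gt_of_ne h0 with h | h <;> simp [h]
  rw [div_pow, div_pow, mul_pow, Real.sq_sqrt (by positivity), hs]
  field_simp
  norm_num

/-- The function `t ↦ 1 / (c |t - a|)` has infinite integral over an interval around `a`. -/
theorem lintegral_one_div_mul_abs_sub_eq_top {a b c d : ℝ} (hc : 0 < c) (ha : a ∈ Set.Ioo b d) :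
    ∫⁻ t in Set.Ioo b d, ENNReal.ofReal (1 / (c * |t - a|)) = ⊤ := by
  by_contra h
  have hbd : b < d := ha.1.trans ha.2
  have hint : Integrable (fun t => 1 / (c * |t - a|)) (volume.restrict (Set.Ioo b d)) :=
    (lintegral_ofReal_ne_top_iff_integrable
      (by measurability : Measurable _).aestronglyMeasurable
      (ae_of_all _ fun t => by simp only [Pi.zero_apply]; positivity)).mp h
  have hinv : IntegrableOn (fun t => (t - a)⁻¹) (Set.Ioo b d) := by
    refine (hint.const_mul c).mono' (by fun_prop) (ae_of_all _ fun t => le_of_eq ?_)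
    rw [norm_inv, Real.norm_eq_abs, one_div, mul_inv, mul_inv_cancel_left₀ hc.ne']
  have hii : IntervalIntegrable (fun t => (t - a)⁻¹) volume b d :=
    (intervalIntegrable_iff_integrableOn_Ioo_of_le hbd.le).mpr hinv
  rcases intervalIntegrable_sub_inv_iff.mp hii with h | h
  · exact hbd.ne h
  · exact h (Set.Icc_subset_uIcc ⟨ha.1.le, ha.2.le⟩)



/-- The sharp-peaked boundary datum `g₁` is differentiable on `(0, 2π)` away from
`{π/2, π, 3π/2}`, the square of its derivative on `(0, π) \ {π/2}` is `1/(8π|t − π/2|)`, and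
`∫₀^π 1/(8π|t − π/2|) dt = ∞`; consequently `g₁ ∉ H¹((0, 2π))`. -/
theorem stmt_7 (g₁ : ℝ → ℝ)
    (hg₁ : ∀ t, g₁ t =
      if t < π then 1 / 2 - Real.sqrt (|t - π / 2| / (2 * π))
      else Real.sqrt (|t - 3 * π / 2| / (2 * π)) - 1 / 2) :
    (∀ t ∈ Set.Ioo (0 : ℝ) (2 * π), t ≠ π / 2 → t ≠ π → t ≠ 3 * π / 2 →
      DifferentiableAt ℝ g₁ t) ∧
    (∀ t ∈ Set.Ioo (0 : ℝ) π, t ≠ π / 2 →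
      (deriv g₁ t) ^ 2 = 1 / (8 * π * |t - π / 2|)) ∧
    (∫⁻ t in Set.Ioo (0 : ℝ) π, ENNReal.ofReal (1 / (8 * π * |t - π / 2|))) = ⊤ := by
  have hleft : ∀ t, t < π → t ≠ π / 2 → HasDerivAt g₁
      (-((SignType.sign (t - π / 2) : ℝ) / (2 * π) / (2 * √(|t - π / 2| / (2 * π))))) t := by
    intro t ht hne
    refine ((hasDerivAt_sqrt_abs_sub_div two_pi_pos hne).const_sub (1 / 2)).congr_of_eventuallyEq ?_
    filter_upwards [Iio_mem_nhds ht] with s hs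
    rw [hg₁, if_pos (Set.mem_Iio.mp hs)]
  refine ⟨fun t _ h1 h2 h3 => ?_, fun t ht hne => ?_, ?_⟩
  · rcases lt_or_gt_of_ne h2 with h | h
    · exact (hleft t h h1).differentiableAt
    · refine ((hasDerivAt_sqrt_abs_sub_div two_pi_pos h3).sub_const
        (1 / 2)).differentiableAt.congr_of_eventuallyEq ?_
      filter_upwards [Ioi_mem_nhds h] with s hs
      rw [hg₁, if_neg (not_lt.mpr (le_of_lt hs))]
  · rw [(hleft t ht.2 hne).deriv, neg_sq, sq_deriv_sqrt_abs_sub_div two_pi_pos hne]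
    ring
  · exact lintegral_one_div_mul_abs_sub_eq_top (by positivity) ⟨pi_div_two_pos, half_lt_self pi_pos⟩
end

section
/- Let n ≥ 1 and let P ∈ Matrix (Fin n) (Fin n) ℝ be the cyclic permutation matrix defined by P_{i,j} = 1 if j ≡ i + 1 (mod n) and P_{i,j} = 0 otherwise. Then the matrix M := (2/n + 4)·I − 2·(P + Pᵀ) is symmetric and positive definite: Mᵀ = M and vᵀ M v > 0 for every nonzero v ∈ ℝⁿ. -/
open Matrix

/-- A real matrix with `P * Pᵀ = 1` has `2 • 1 - (P + Pᵀ) = (1 - P) * (1 - P)ᵀ` positive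
semidefinite. -/
theorem Matrix.posSemidef_two_sub_add_transpose {ι : Type*} [Fintype ι] [DecidableEq ι]
    {P : Matrix ι ι ℝ} (h : P * Pᵀ = 1) :
    ((2 : ℝ) • (1 : Matrix ι ι ℝ) - (P + Pᵀ)).PosSemidef := by
  have key : (2 : ℝ) • (1 : Matrix ι ι ℝ) - (P + Pᵀ) = (1 - P) * (1 - P)ᴴ := by
    rw [conjTranspose_eq_transpose_of_trivial, transpose_sub, transpose_one, sub_mul, mul_sub,
      mul_sub, h, two_smul]
    simp only [one_mul, mul_one]
    abel
  rw [key]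
  exact posSemidef_self_mul_conjTranspose _

theorem Matrix.eq_permMatrix_finRotate {n : ℕ} {P : Matrix (Fin n) (Fin n) ℝ}
    (hP : ∀ i j, P i j = if (j : ℕ) = ((i : ℕ) + 1) % n then 1 else 0) :
    P = (finRotate n).permMatrix ℝ := by
  cases n with
  | zero => exact Subsingleton.elim _ _
  | succ m =>
    ext i j
    have hval : ((i + 1 : Fin (m + 1)) : ℕ) = ((i : ℕ) + 1) % (m + 1) := by
      simp [Fin.val_add]
    simp [hP, ← hval, Equiv.Perm.permMatrix, PEquiv.toMatrix_apply, Fin.ext_iff, eq_comm]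

theorem Matrix.permMatrix_mul_transpose_self {ι : Type*} [Fintype ι] [DecidableEq ι]
    (σ : Equiv.Perm ι) : σ.permMatrix ℝ * (σ.permMatrix ℝ)ᵀ = 1 := by
  rw [transpose_permMatrix, ← permMatrix_mul, inv_mul_cancel, permMatrix_one]

/-- For the `n × n` cyclic permutation matrix `P`, the TRPINN boundary matrix
`M = (2/n + 4)·I − 2·(P + Pᵀ)` is symmetric and positive definite. -/
theorem stmt_9 (n : ℕ) (hn : 1 ≤ n) (P : Matrix (Fin n) (Fin n) ℝ)
    (hP : ∀ i j, P i j = if (j : ℕ) = ((i : ℕ) + 1) % n then 1 else 0)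
    (M : Matrix (Fin n) (Fin n) ℝ)
    (hM : M = (2 / (n : ℝ) + 4) • (1 : Matrix (Fin n) (Fin n) ℝ) - (2 : ℝ) • (P + Pᵀ)) :
    Mᵀ = M ∧ M.PosDef := by
  have hPP : P * Pᵀ = 1 := by
    rw [eq_permMatrix_finRotate hP]
    exact permMatrix_mul_transpose_self _
  have hsplit : M = (2 / (n : ℝ)) • (1 : Matrix (Fin n) (Fin n) ℝ)
      + (2 : ℝ) • ((2 : ℝ) • (1 : Matrix (Fin n) (Fin n) ℝ) - (P + Pᵀ)) := by
    rw [hM]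
    module
  have hpos : (0 : ℝ) < 2 / n := by positivity
  have hdef : M.PosDef := by
    rw [hsplit]
    exact (PosDef.one.smul hpos).add_posSemidef
      ((posSemidef_two_sub_add_transpose hPP).smul zero_le_two)
  exact ⟨by simpa using hdef.isHermitian.eq, hdef⟩
end

section
/- Let N_b, N_r ≥ 1, let m = N_b + N_r, and let P be the N_b × N_b real cyclic permutation matrix, M := (2/N_b + 4)·I − 2·(P + Pᵀ). Define the symmetric positive semidefinite block-diagonal matrices D_p := blockdiag((2/N_b)·I_{N_b}, (2/N_r)·I_{N_r}) and D_h := blockdiag(M, (2/N_r)·I_{N_r}) of size m × m. Let K be any m × m real symmetric positive semidefinite matrix with positive semidefinite square root K^{1/2}. Then for every index i, the i-th eigenvalue (in increasing order) of the symmetric matrix K^{1/2} D_p K^{1/2} is less than or equal to the i-th eigenvalue (in increasing order) of the symmetric matrix K^{1/2} D_h K^{1/2}. -/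
open Matrix

namespace Matrix

section Eigenvalues

variable {𝕜 : Type*} [RCLike 𝕜]

namespace IsHermitian

variable {ι : Type*} [Fintype ι] [DecidableEq ι] {A : Matrix ι ι 𝕜}

lemma toEuclideanLin_eigenvectorBasis (hA : A.IsHermitian) (j : ι) :
    A.toEuclideanLin (hA.eigenvectorBasis j) =
      (hA.eigenvalues j : 𝕜) • hA.eigenvectorBasis j := by
  ext k
  simpa [RCLike.real_smul_eq_coe_mul] using congrFun (hA.mulVec_eigenvectorBasis j) k

lemma inner_toEuclideanLin_self (hA : A.IsHermitian) (x : EuclideanSpace 𝕜 ι) :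
    RCLike.re (inner 𝕜 x (A.toEuclideanLin x)) =
      ∑ j, hA.eigenvalues j * ‖inner 𝕜 (hA.eigenvectorBasis j) x‖ ^ 2 := by
  rw [← hA.eigenvectorBasis.sum_inner_mul_inner, map_sum]
  refine Finset.sum_congr rfl fun j _ => ?_
  rw [← isSymmetric_toEuclideanLin_iff.mpr hA, hA.toEuclideanLin_eigenvectorBasis,
    inner_smul_left, RCLike.conj_ofReal, mul_left_comm, RCLike.re_ofReal_mul,
    inner_mul_symm_re_eq_norm, norm_mul, norm_inner_symm x, sq]

/-- If `x` is orthogonal to every eigenvector with eigenvalue below `c`, the quadratic form of `A`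
at `x` is at least `c * ‖x‖ ^ 2`. -/
lemma mul_norm_sq_le_inner_toEuclideanLin (hA : A.IsHermitian) {c : ℝ} {x : EuclideanSpace 𝕜 ι}
    (h : ∀ j, hA.eigenvalues j < c → inner 𝕜 (hA.eigenvectorBasis j) x = 0) :
    c * ‖x‖ ^ 2 ≤ RCLike.re (inner 𝕜 x (A.toEuclideanLin x)) := by
  rw [hA.inner_toEuclideanLin_self, ← hA.eigenvectorBasis.sum_sq_norm_inner_right x,
    Finset.mul_sum]
  refine Finset.sum_le_sum fun j _ => ?_
  obtain hj | hj := lt_or_ge (hA.eigenvalues j) c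
  · simp [h j hj]
  · gcongr

/-- If `x` is orthogonal to every eigenvector with eigenvalue above `c`, the quadratic form of `A`
at `x` is at most `c * ‖x‖ ^ 2`. -/
lemma inner_toEuclideanLin_le_mul_norm_sq (hA : A.IsHermitian) {c : ℝ} {x : EuclideanSpace 𝕜 ι}
    (h : ∀ j, c < hA.eigenvalues j → inner 𝕜 (hA.eigenvectorBasis j) x = 0) :
    RCLike.re (inner 𝕜 x (A.toEuclideanLin x)) ≤ c * ‖x‖ ^ 2 := by
  rw [hA.inner_toEuclideanLin_self, ← hA.eigenvectorBasis.sum_sq_norm_inner_right x,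
    Finset.mul_sum]
  refine Finset.sum_le_sum fun j _ => ?_
  obtain hj | hj := lt_or_ge c (hA.eigenvalues j)
  · simp [h j hj]
  · gcongr

open scoped ComplexOrder in
/-- **Weyl's monotonicity principle**: the eigenvalues of a Hermitian matrix, sorted in increasing
order, are monotone in the Loewner order. -/
theorem eigenvalues_sort_le_of_posSemidef_sub {n : ℕ} {A B : Matrix (Fin n) (Fin n) 𝕜}
    (hA : A.IsHermitian) (hB : B.IsHermitian) (hAB : (B - A).PosSemidef) (i : Fin n) :
    hA.eigenvalues (Tuple.sort hA.eigenvalues i) ≤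
      hB.eigenvalues (Tuple.sort hB.eigenvalues i) := by
  set σ := Tuple.sort hA.eigenvalues
  set τ := Tuple.sort hB.eigenvalues
  have hσ : Monotone (hA.eigenvalues ∘ σ) := Tuple.monotone_sort _
  have hτ : Monotone (hB.eigenvalues ∘ τ) := Tuple.monotone_sort _
  let w (j : Fin n) : EuclideanSpace 𝕜 (Fin n) :=
    if j < i then hA.eigenvectorBasis (σ j) else hB.eigenvectorBasis (τ j)
  let f : EuclideanSpace 𝕜 (Fin n) →ₗ[𝕜] ({j // j ≠ i} → 𝕜) :=
    LinearMap.pi fun j => innerₛₗ 𝕜 (w j)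
  have hf : LinearMap.ker f ≠ ⊥ := by
    refine LinearMap.ker_ne_bot_of_finrank_lt ?_
    rw [Module.finrank_fintype_fun_eq_card, finrank_euclideanSpace]
    exact Fintype.card_subtype_lt (x := i) (by simp)
  obtain ⟨x, hx, hx0⟩ := (Submodule.ne_bot_iff _).mp hf
  have hw (j : Fin n) (hj : j ≠ i) : inner 𝕜 (w j) x = 0 :=
    congrFun (LinearMap.mem_ker.mp hx) ⟨j, hj⟩
  have hlow := hA.mul_norm_sq_le_inner_toEuclideanLin (c := hA.eigenvalues (σ i)) (x := x)
    fun j hj => by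
      obtain ⟨k, rfl⟩ := σ.surjective j
      have hk : k < i := hσ.reflect_lt hj
      simpa [w, hk] using hw k hk.ne
  have hupp := hB.inner_toEuclideanLin_le_mul_norm_sq (c := hB.eigenvalues (τ i)) (x := x)
    fun j hj => by
      obtain ⟨k, rfl⟩ := τ.surjective j
      have hk : i < k := hτ.reflect_lt hj
      simpa [w, hk.not_gt] using hw k hk.ne'
  have hmid : 0 ≤ RCLike.re (inner 𝕜 x ((B - A).toEuclideanLin x)) :=
    (isPositive_toEuclideanLin_iff.mpr hAB).re_inner_nonneg_right x
  rw [map_sub, LinearMap.sub_apply, inner_sub_right, map_sub, sub_nonneg] at hmid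
  exact le_of_mul_le_mul_right (hlow.trans (hmid.trans hupp)) (by positivity)

end IsHermitian

end Eigenvalues

lemma PosSemidef.fromBlocks_zero {m n R : Type*} [Finite m] [Finite n] [Ring R] [PartialOrder R]
    [StarRing R] [StarOrderedRing R] {A : Matrix m m R} {D : Matrix n n R}
    (hA : A.PosSemidef) (hD : D.PosSemidef) : (fromBlocks A 0 0 D).PosSemidef := by
  have := Fintype.ofFinite m
  have := Fintype.ofFinite n
  refine .of_dotProduct_mulVec_nonneg (hA.1.fromBlocks (by simp) hD.1) fun x => ?_
  rw [fromBlocks_mulVec, dotProduct, Fintype.sum_sum_type]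
  simpa [dotProduct] using add_nonneg (hA.dotProduct_mulVec_nonneg (x ∘ Sum.inl))
    (hD.dotProduct_mulVec_nonneg (x ∘ Sum.inr))

lemma posSemidef_two_smul_one_sub_permMatrix {n : Type*} [Fintype n] [DecidableEq n]
    (σ : Equiv.Perm n) :
    ((2 : ℝ) • (1 : Matrix n n ℝ) - (σ.permMatrix ℝ + (σ.permMatrix ℝ)ᵀ)).PosSemidef := by
  have hσ : (σ.permMatrix ℝ)ᵀ * σ.permMatrix ℝ = 1 := by
    rw [transpose_permMatrix, ← permMatrix_mul, mul_inv_cancel, permMatrix_one]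
  convert posSemidef_conjTranspose_mul_self (1 - σ.permMatrix ℝ) using 1
  rw [conjTranspose_eq_transpose_of_trivial, transpose_sub, transpose_one, sub_mul, mul_sub,
    mul_sub, hσ, one_mul, one_mul, mul_one, two_smul]
  abel

lemma exists_eq_permMatrix_of_cyclic {R : Type*} [Zero R] [One R] {n : ℕ} (hn : 1 ≤ n)
    {P : Matrix (Fin n) (Fin n) R}
    (hP : ∀ i j, P i j = if (j : ℕ) = ((i : ℕ) + 1) % n then 1 else 0) :
    ∃ σ : Equiv.Perm (Fin n), P = σ.permMatrix R := by
  have : NeZero n := ⟨by lia⟩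
  refine ⟨Equiv.addRight 1, ?_⟩
  ext i j
  simp [hP, PEquiv.toMatrix_apply, Fin.ext_iff, Fin.val_add, eq_comm]

end Matrix

/-- NTK eigenvalue comparison between PINN and TRPINN: with
`D_p = blockdiag((2/N_b)I, (2/N_r)I)`, `D_h = blockdiag(M, (2/N_r)I)` where
`M = (2/N_b + 4)I − 2(P + Pᵀ)` and `P` is the cyclic permutation matrix, and `K = R·R` a
symmetric PSD kernel with PSD square root `R`, the `i`-th smallest eigenvalue of
`R D_p R` is at most the `i`-th smallest eigenvalue of `R D_h R`. -/
theorem stmt_11 (Nb Nr : ℕ) (hb : 1 ≤ Nb) (hr : 1 ≤ Nr)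
    (P : Matrix (Fin Nb) (Fin Nb) ℝ)
    (hP : ∀ i j, P i j = if (j : ℕ) = ((i : ℕ) + 1) % Nb then 1 else 0)
    (M : Matrix (Fin Nb) (Fin Nb) ℝ)
    (hM : M = (2 / (Nb : ℝ) + 4) • (1 : Matrix (Fin Nb) (Fin Nb) ℝ) - (2 : ℝ) • (P + Pᵀ))
    (Dp Dh : Matrix (Fin (Nb + Nr)) (Fin (Nb + Nr)) ℝ)
    (hDp : Dp = Matrix.reindex finSumFinEquiv finSumFinEquiv
      (Matrix.fromBlocks ((2 / (Nb : ℝ)) • 1) 0 0 ((2 / (Nr : ℝ)) • 1)))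
    (hDh : Dh = Matrix.reindex finSumFinEquiv finSumFinEquiv
      (Matrix.fromBlocks M 0 0 ((2 / (Nr : ℝ)) • 1)))
    (K R : Matrix (Fin (Nb + Nr)) (Fin (Nb + Nr)) ℝ)
    (hK : K.PosSemidef) (hR : R.PosSemidef) (hRK : R * R = K)
    (hAp : (R * Dp * R).IsHermitian) (hAh : (R * Dh * R).IsHermitian) :
    ∀ i : Fin (Nb + Nr),
      hAp.eigenvalues (Tuple.sort hAp.eigenvalues i)
        ≤ hAh.eigenvalues (Tuple.sort hAh.eigenvalues i) := by
  obtain ⟨σ, rfl⟩ := exists_eq_permMatrix_of_cyclic hb hP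
  refine hAp.eigenvalues_sort_le_of_posSemidef_sub hAh ?_
  have hM' : (M - (2 / (Nb : ℝ)) • 1).PosSemidef := by
    convert (posSemidef_two_smul_one_sub_permMatrix σ).smul zero_le_two (α := ℝ) using 1
    rw [hM]
    module
  have hD : (Dh - Dp).PosSemidef := by
    convert (hM'.fromBlocks_zero (.zero (n := Fin Nr))).submatrix finSumFinEquiv.symm using 1
    have h : fromBlocks (M - (2 / (Nb : ℝ)) • 1) 0 0 0 =
        fromBlocks M 0 0 ((2 / (Nr : ℝ)) • (1 : Matrix (Fin Nr) (Fin Nr) ℝ)) -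
          fromBlocks ((2 / (Nb : ℝ)) • 1) 0 0 ((2 / (Nr : ℝ)) • 1) := by
      simp [sub_eq_add_neg, fromBlocks_neg, fromBlocks_add]
    rw [hDh, hDp, h]
    rfl
  have := hD.conjTranspose_mul_mul_same R
  rwa [hR.isHermitian.eq, mul_sub, sub_mul] at this
end
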